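/- (Theorem 2, non-abelian Stokes theorem, surface-integral form.) With the Wilson-loop setup below, fix σ ∈ ℝ and let Y : ℝ → Matrix (Fin n) (Fin n) ℂ be the unique solution of Y'(τ') = (∫_{σ₀}^{σ} T(σ', τ')⁻¹ * F₀₁(σ', τ') * T(σ', τ') dσ') * Y(τ') with Y(τ₀) = 1, where F₀₁ = ∂_σ A₀ − ∂_τ A₁ + [A₀, A₁]. Then W(σ, τ) = Y(τ) for every τ ∈ ℝ; that is, the Wilson loop operator admits the surface product-integral representation W = ∏_{τ₀}^{τ} e^{∫_{σ₀}^{σ} T⁻¹(σ';τ') F₀₁(σ';τ') T(σ';τ') dσ' dτ'}. -/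

import Mathlib

attribute [local instance] Matrix.linftyOpNormedAddCommGroup Matrix.linftyOpNormedRing
  Matrix.linftyOpNormedSpace Matrix.linftyOpNormedAlgebra

section BanachAlgebra

open Set Filter Topology

variable {E : Type*} [NormedRing E] [NormedAlgebra ℝ E]

theorem norm_le_mul_exp_of_hasDerivAt_mul {f A : ℝ → E}
    (hf : ∀ s, HasDerivAt f (A s * f s) s) {a b C : ℝ} (hA : ∀ s ∈ uIcc a b, ‖A s‖ ≤ C) :
    ‖f b‖ ≤ ‖f a‖ * Real.exp (C * |b - a|) := by
  set γ : ℝ → ℝ := fun r => a + r * (b - a) with hγ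
  have hγ' : ∀ r, HasDerivAt γ (b - a) r := fun r => by
    simpa [hγ] using! ((hasDerivAt_id r).mul_const (b - a)).const_add a
  have hd : ∀ r, HasDerivAt (f ∘ γ) ((b - a) • (A (γ r) * f (γ r))) r := fun r =>
    (hf (γ r)).scomp r (hγ' r)
  have key := norm_le_gronwallBound_of_norm_deriv_right_le (f := f ∘ γ)
    (δ := ‖f a‖) (K := C * |b - a|) (ε := 0) (a := 0) (b := 1)
    (fun r _ => (hd r).continuousAt.continuousWithinAt)
    (fun r _ => (hd r).hasDerivWithinAt) (by simp [hγ]) (fun r hr => by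
      have hmem : γ r ∈ uIcc a b := by
        rw [← segment_eq_uIcc, segment_eq_image']
        exact ⟨r, ⟨hr.1, hr.2.le⟩, by simp [hγ]⟩
      calc ‖(b - a) • (A (γ r) * f (γ r))‖ = |b - a| * ‖A (γ r) * f (γ r)‖ := by
            rw [norm_smul, Real.norm_eq_abs]
        _ ≤ |b - a| * (C * ‖f (γ r)‖) := by
            gcongr
            exact (norm_mul_le _ _).trans (by gcongr; exact hA _ hmem)
        _ = C * |b - a| * ‖(f ∘ γ) r‖ + 0 := by simp only [Function.comp]; ring)
    1 (by simp)
  simpa [gronwallBound_ε0, hγ] using key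

variable [CompleteSpace E]

theorem HasDerivAt.ringInverse {f : ℝ → E} {f' : E} {x : ℝ} (hf : HasDerivAt f f' x)
    (hx : IsUnit (f x)) :
    HasDerivAt (fun y => Ring.inverse (f y))
      (-(Ring.inverse (f x) * f' * Ring.inverse (f x))) x := by
  obtain ⟨u, hu⟩ := hx
  have h := hasFDerivAt_ringInverse (𝕜 := ℝ) u
  rw [hu] at h
  simpa [← hu] using! h.comp_hasDerivAt x hf

/-- Two solutions of the same linear equation agree if one of them is invertible; no regularity of
the coefficient is needed. -/
theorem eq_of_hasDerivAt_mul {f g M : ℝ → E} (hf : ∀ t, HasDerivAt f (M t * f t) t)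
    (hg : ∀ t, HasDerivAt g (M t * g t) t) (hunit : ∀ t, IsUnit (f t)) {t₀ : ℝ}
    (h₀ : f t₀ = g t₀) (t : ℝ) : f t = g t := by
  have hd : ∀ t, HasDerivAt (fun t => Ring.inverse (f t) * g t) 0 t := fun t => by
    refine (((hf t).ringInverse (hunit t)).mul (hg t)).congr_deriv ?_
    have := Ring.mul_inverse_cancel _ (hunit t)
    simp only [mul_assoc, neg_mul]
    rw [← mul_assoc (f t), this, one_mul, neg_add_cancel]
  have hc := is_const_of_deriv_eq_zero (fun t => (hd t).differentiableAt)
    (fun t => (hd t).deriv) t t₀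
  simp only [← h₀, Ring.inverse_mul_cancel _ (hunit t₀)] at hc
  calc f t = f t * (Ring.inverse (f t) * g t) := by rw [hc, mul_one]
    _ = g t := Ring.mul_inverse_cancel_left _ _ (hunit t)

section PartialDerivatives

variable {V : Type*} [NormedAddCommGroup V] [NormedSpace ℝ V] {A : ℝ → ℝ → V}

theorem ContDiff.hasDerivAt_partial_left (hA : ContDiff ℝ 1 fun p : ℝ × ℝ => A p.1 p.2)
    (s t : ℝ) :
    HasDerivAt (fun s => A s t) (fderiv ℝ (fun p : ℝ × ℝ => A p.1 p.2) (s, t) (1, 0)) s :=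
  (hA.differentiable one_ne_zero (s, t)).hasFDerivAt.comp_hasDerivAt (f := fun s => (s, t)) s
    ((hasDerivAt_id s).prodMk (hasDerivAt_const s t))

theorem ContDiff.hasDerivAt_partial_right (hA : ContDiff ℝ 1 fun p : ℝ × ℝ => A p.1 p.2)
    (s t : ℝ) :
    HasDerivAt (fun t => A s t) (fderiv ℝ (fun p : ℝ × ℝ => A p.1 p.2) (s, t) (0, 1)) t :=
  (hA.differentiable one_ne_zero (s, t)).hasFDerivAt.comp_hasDerivAt (f := fun t => (s, t)) t
    ((hasDerivAt_const t s).prodMk (hasDerivAt_id t))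

theorem ContDiff.continuous_deriv_left (hA : ContDiff ℝ 1 fun p : ℝ × ℝ => A p.1 p.2) :
    Continuous fun p : ℝ × ℝ => deriv (fun s => A s p.2) p.1 := by
  simp only [fun p : ℝ × ℝ => (hA.hasDerivAt_partial_left p.1 p.2).deriv]
  exact (hA.continuous_fderiv one_ne_zero).clm_apply continuous_const

theorem ContDiff.continuous_deriv_right (hA : ContDiff ℝ 1 fun p : ℝ × ℝ => A p.1 p.2) :
    Continuous fun p : ℝ × ℝ => deriv (fun t => A p.1 t) p.2 := by
  simp only [fun p : ℝ × ℝ => (hA.hasDerivAt_partial_right p.1 p.2).deriv]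
  exact (hA.continuous_fderiv one_ne_zero).clm_apply continuous_const

end PartialDerivatives

section Propagator

variable {A P : ℝ → ℝ → E} {σ₀ : ℝ}

theorem hasDerivAt_inverse_mul_propagator
    (hP : ∀ s t, HasDerivAt (fun s => P s t) (A s t * P s t) s)
    (hPinv : ∀ s t, IsUnit (P s t)) (s t τ : ℝ) :
    HasDerivAt (fun s => Ring.inverse (P s τ) * P s t)
      (Ring.inverse (P s τ) * (A s t - A s τ) * P s t) s := by
  refine (((hP s τ).ringInverse (hPinv s τ)).mul (hP s t)).congr_deriv ?_
  have h : P s τ * Ring.inverse (P s τ) = 1 := Ring.mul_inverse_cancel _ (hPinv s τ)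
  calc _ = -(Ring.inverse (P s τ) * A s τ * (P s τ * Ring.inverse (P s τ)) * P s t)
        + Ring.inverse (P s τ) * (A s t * P s t) := by noncomm_ring
    _ = _ := by rw [h]; noncomm_ring

theorem continuous_inverse_propagator
    (hP : ∀ s t, HasDerivAt (fun s => P s t) (A s t * P s t) s)
    (hPinv : ∀ s t, IsUnit (P s t)) (t : ℝ) : Continuous fun s => Ring.inverse (P s t) :=
  continuous_iff_continuousAt.2 fun s => ((hP s t).ringInverse (hPinv s t)).continuousAt

theorem exists_norm_inverse_mul_sub_mul_propagator_le
    (hA : ContDiff ℝ 1 fun p : ℝ × ℝ => A p.1 p.2)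
    (hP : ∀ s t, HasDerivAt (fun s => P s t) (A s t * P s t) s) (hP0 : ∀ t, P σ₀ t = 1)
    (hPinv : ∀ s t, IsUnit (P s t)) (σ τ : ℝ) :
    ∃ K : ℝ, ∀ s ∈ uIcc σ₀ σ, ∀ t ∈ Icc (τ - 1) (τ + 1),
      ‖Ring.inverse (P s τ) * (A s t - A s τ) * P s t‖ ≤ K * |t - τ| := by
  have hbox : IsCompact (uIcc σ₀ σ ×ˢ Icc (τ - 1) (τ + 1)) := isCompact_uIcc.prod isCompact_Icc
  obtain ⟨C, hC⟩ := hbox.exists_bound_of_continuousOn hA.continuous.continuousOn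
  obtain ⟨L, hL⟩ := hbox.exists_bound_of_continuousOn hA.continuous_deriv_right.continuousOn
  obtain ⟨D, hD⟩ := isCompact_uIcc.exists_bound_of_continuousOn (s := uIcc σ₀ σ)
    (continuous_inverse_propagator hP hPinv τ).continuousOn
  have hτ : τ ∈ Icc (τ - 1) (τ + 1) := by constructor <;> linarith
  have hC0 : 0 ≤ C := (norm_nonneg _).trans (hC (σ₀, τ) ⟨left_mem_uIcc, hτ⟩)
  have hD0 : 0 ≤ D := (norm_nonneg _).trans (hD σ₀ left_mem_uIcc)
  have hL0 : 0 ≤ L := (norm_nonneg _).trans (hL (σ₀, τ) ⟨left_mem_uIcc, hτ⟩)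
  refine ⟨D * L * (‖(1 : E)‖ * Real.exp (C * |σ - σ₀|)), fun s hs t ht => ?_⟩
  have hsub : uIcc σ₀ s ⊆ uIcc σ₀ σ := uIcc_subset_uIcc_left hs
  have hPle : ‖P s t‖ ≤ ‖(1 : E)‖ * Real.exp (C * |σ - σ₀|) := by
    have h := norm_le_mul_exp_of_hasDerivAt_mul (fun s => hP s t) (a := σ₀) (b := s) (C := C)
      fun r hr => hC (r, t) ⟨hsub hr, ht⟩
    rw [hP0] at h
    refine h.trans ?_
    have := abs_sub_left_of_mem_uIcc hs
    gcongr
  have hAle : ‖A s t - A s τ‖ ≤ L * |t - τ| :=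
    (convex_Icc (τ - 1) (τ + 1)).norm_image_sub_le_of_norm_deriv_le
      (fun r _ => (hA.hasDerivAt_partial_right s r).differentiableAt)
      (fun r hr => hL (s, r) ⟨hs, hr⟩) hτ ht
  calc _ ≤ ‖Ring.inverse (P s τ)‖ * ‖A s t - A s τ‖ * ‖P s t‖ := norm_mul₃_le
    _ ≤ D * (L * |t - τ|) * (‖(1 : E)‖ * Real.exp (C * |σ - σ₀|)) := by
        gcongr
        exact hD s hs
    _ = _ := by ring

theorem continuousAt_propagator_right
    (hA : ContDiff ℝ 1 fun p : ℝ × ℝ => A p.1 p.2)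
    (hP : ∀ s t, HasDerivAt (fun s => P s t) (A s t * P s t) s) (hP0 : ∀ t, P σ₀ t = 1)
    (hPinv : ∀ s t, IsUnit (P s t)) (σ τ : ℝ) : ContinuousAt (fun t => P σ t) τ := by
  obtain ⟨K, hK⟩ := exists_norm_inverse_mul_sub_mul_propagator_le hA hP hP0 hPinv σ τ
  have hle : ∀ᶠ t in 𝓝 τ,
      ‖Ring.inverse (P σ τ) * P σ t - 1‖ ≤ K * |t - τ| * |σ - σ₀| := by
    filter_upwards [Icc_mem_nhds (sub_one_lt τ) (lt_add_one τ)] with t ht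
    have := (convex_uIcc σ₀ σ).norm_image_sub_le_of_norm_hasDerivWithin_le
      (fun s _ => (hasDerivAt_inverse_mul_propagator hP hPinv s t τ).hasDerivWithinAt)
      (fun s hs => hK s hs t ht) left_mem_uIcc right_mem_uIcc
    simpa [hP0] using this
  have hlim : Tendsto (fun t => K * |t - τ| * |σ - σ₀|) (𝓝 τ) (𝓝 0) := by
    have : Continuous fun t => K * |t - τ| * |σ - σ₀| := by fun_prop
    simpa using this.tendsto τ
  have h1 : Tendsto (fun t => Ring.inverse (P σ τ) * P σ t) (𝓝 τ) (𝓝 1) :=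
    tendsto_iff_norm_sub_tendsto_zero.2
      (squeeze_zero' (Eventually.of_forall fun _ => norm_nonneg _) hle hlim)
  simpa [ContinuousAt, Ring.mul_inverse_cancel_left _ _ (hPinv σ τ)] using h1.const_mul (P σ τ)

/-- Differentiation of the propagator of a linear equation with respect to a parameter. -/
theorem hasDerivAt_propagator_right
    (hA : ContDiff ℝ 1 fun p : ℝ × ℝ => A p.1 p.2)
    (hP : ∀ s t, HasDerivAt (fun s => P s t) (A s t * P s t) s) (hP0 : ∀ t, P σ₀ t = 1)
    (hPinv : ∀ s t, IsUnit (P s t)) (σ τ : ℝ) :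
    HasDerivAt (fun t => P σ t)
      (P σ τ * ∫ s in σ₀..σ, Ring.inverse (P s τ) * deriv (fun t => A s t) τ * P s τ) τ := by
  have hcP : ∀ t, Continuous fun s => P s t := fun t =>
    continuous_iff_continuousAt.2 fun s => (hP s t).continuousAt
  have hcA : ∀ t, Continuous fun s => A s t := fun t =>
    continuous_iff_continuousAt.2 fun s => (hA.hasDerivAt_partial_left s t).continuousAt
  have hcF : ∀ t, Continuous fun s => Ring.inverse (P s τ) * (A s t - A s τ) * P s t := fun t =>
    ((continuous_inverse_propagator hP hPinv τ).mul ((hcA t).sub (hcA τ))).mul (hcP t)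
  have duhamel : ∀ t, ∫ s in σ₀..σ, Ring.inverse (P s τ) * (A s t - A s τ) * P s t
      = Ring.inverse (P σ τ) * P σ t - 1 := fun t => by
    rw [intervalIntegral.integral_eq_sub_of_hasDerivAt
      (fun s _ => hasDerivAt_inverse_mul_propagator hP hPinv s t τ)
      ((hcF t).intervalIntegrable _ _)]
    simp [hP0]
  have key : HasDerivAt (fun t => Ring.inverse (P σ τ) * P σ t - 1)
      (∫ s in σ₀..σ, Ring.inverse (P s τ) * deriv (fun t => A s t) τ * P s τ) τ := by
    rw [hasDerivAt_iff_tendsto_slope]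
    obtain ⟨K, hK⟩ := exists_norm_inverse_mul_sub_mul_propagator_le hA hP hP0 hPinv σ τ
    have hslope : slope (fun t => Ring.inverse (P σ τ) * P σ t - 1) τ = fun t =>
        ∫ s in σ₀..σ, (t - τ)⁻¹ • (Ring.inverse (P s τ) * (A s t - A s τ) * P s t) := by
      funext t
      rw [intervalIntegral.integral_smul, duhamel t, slope_def_module,
        Ring.inverse_mul_cancel _ (hPinv σ τ), sub_self, sub_zero]
    rw [hslope]
    refine intervalIntegral.tendsto_integral_filter_of_dominated_convergence (fun _ => K)
      (Eventually.of_forall fun t => ((hcF t).const_smul _).aestronglyMeasurable) ?_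
      intervalIntegrable_const (Eventually.of_forall fun s _ => ?_)
    · filter_upwards [self_mem_nhdsWithin,
        mem_nhdsWithin_of_mem_nhds (Icc_mem_nhds (sub_one_lt τ) (lt_add_one τ))] with t hne ht
      refine Eventually.of_forall fun s hs => ?_
      have hpos : 0 < |t - τ| := abs_pos.2 (sub_ne_zero.2 hne)
      rw [norm_smul, norm_inv, Real.norm_eq_abs, inv_mul_le_iff₀ hpos, mul_comm]
      exact hK s (uIoc_subset_uIcc hs) t ht
    · have h1 := (hA.hasDerivAt_partial_right s τ).differentiableAt.hasDerivAt.tendsto_slope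
      have h2 := (continuousAt_propagator_right hA hP hP0 hPinv s τ).tendsto.mono_left
        (nhdsWithin_le_nhds (s := {τ}ᶜ))
      refine ((h1.const_mul (Ring.inverse (P s τ))).mul h2).congr fun t => ?_
      rw [slope_def_module, mul_smul_comm, smul_mul_assoc]
  refine ((key.add_const 1).const_mul (P σ τ)).congr_of_eventuallyEq
    (Eventually.of_forall fun t => ?_)
  simp [Ring.mul_inverse_cancel_left _ _ (hPinv σ τ)]

/-- The fundamental theorem of calculus for a parallel-transported field. -/
theorem integral_inverse_mul_covariantDeriv_mul_propagator {A₀ : ℝ → ℝ → E}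
    (hA₀ : ContDiff ℝ 1 fun p : ℝ × ℝ => A₀ p.1 p.2)
    (hA : ContDiff ℝ 1 fun p : ℝ × ℝ => A p.1 p.2)
    (hP : ∀ s t, HasDerivAt (fun s => P s t) (A s t * P s t) s) (hP0 : ∀ t, P σ₀ t = 1)
    (hPinv : ∀ s t, IsUnit (P s t)) (σ τ : ℝ) :
    ∫ s in σ₀..σ, Ring.inverse (P s τ) *
        (deriv (fun s => A₀ s τ) s + (A₀ s τ * A s τ - A s τ * A₀ s τ)) * P s τ
      = Ring.inverse (P σ τ) * A₀ σ τ * P σ τ - A₀ σ₀ τ := by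
  have hcP : Continuous fun s => P s τ :=
    continuous_iff_continuousAt.2 fun s => (hP s τ).continuousAt
  have hpair : Continuous fun s : ℝ => (s, τ) := by fun_prop
  have hcA : Continuous fun s => A s τ := hA.continuous.comp hpair
  have hcA₀ : Continuous fun s => A₀ s τ := hA₀.continuous.comp hpair
  have hcd : Continuous fun s => deriv (fun s => A₀ s τ) s :=
    hA₀.continuous_deriv_left.comp hpair
  rw [intervalIntegral.integral_eq_sub_of_hasDerivAt
    (f := fun s => Ring.inverse (P s τ) * A₀ s τ * P s τ)]
  · simp [hP0]
  · intro s _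
    have hd := (hA₀.hasDerivAt_partial_left s τ).differentiableAt.hasDerivAt
    refine ((((hP s τ).ringInverse (hPinv s τ)).mul hd).mul (hP s τ)).congr_deriv ?_
    have h : P s τ * Ring.inverse (P s τ) = 1 := Ring.mul_inverse_cancel _ (hPinv s τ)
    calc _ = (-(Ring.inverse (P s τ) * A s τ * (P s τ * Ring.inverse (P s τ)) * A₀ s τ)
          + Ring.inverse (P s τ) * deriv (fun s => A₀ s τ) s) * P s τ
          + Ring.inverse (P s τ) * A₀ s τ * (A s τ * P s τ) := by
          simp only [Pi.mul_apply]
          noncomm_ring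
      _ = _ := by rw [h]; noncomm_ring
  · exact Continuous.intervalIntegrable (((continuous_inverse_propagator hP hPinv τ).mul
      (hcd.add ((hcA₀.mul hcA).sub (hcA.mul hcA₀)))).mul hcP) _ _

end Propagator

section WilsonLoop

variable {A₀ A₁ P Q : ℝ → ℝ → E} {σ₀ τ₀ : ℝ}

theorem hasDerivAt_wilsonLoop
    (hA₀ : ContDiff ℝ 1 fun p : ℝ × ℝ => A₀ p.1 p.2)
    (hA₁ : ContDiff ℝ 1 fun p : ℝ × ℝ => A₁ p.1 p.2)
    (hP : ∀ s t, HasDerivAt (fun s => P s t) (A₁ s t * P s t) s) (hP0 : ∀ t, P σ₀ t = 1)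
    (hPinv : ∀ s t, IsUnit (P s t))
    (hQ : ∀ s t, HasDerivAt (fun t => Q s t) (A₀ s t * Q s t) t)
    (hQinv : ∀ s t, IsUnit (Q s t)) (σ τ : ℝ) :
    HasDerivAt (fun t => Ring.inverse (P σ t * Q σ₀ t) * Q σ t * P σ τ₀)
      ((∫ s in σ₀..σ, Ring.inverse (P s τ * Q σ₀ τ) *
          (deriv (fun s => A₀ s τ) s - deriv (fun t => A₁ s t) τ +
            (A₀ s τ * A₁ s τ - A₁ s τ * A₀ s τ)) * (P s τ * Q σ₀ τ)) *
        (Ring.inverse (P σ τ * Q σ₀ τ) * Q σ τ * P σ τ₀)) τ := by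
  have hinv : ∀ s t, Ring.inverse (P s t * Q σ₀ t)
      = Ring.inverse (Q σ₀ t) * Ring.inverse (P s t) := fun s t => by
    obtain ⟨u, hu⟩ := hPinv s t
    obtain ⟨v, hv⟩ := hQinv σ₀ t
    rw [← hu, ← hv, ← Units.val_mul, Ring.inverse_unit, Ring.inverse_unit, Ring.inverse_unit,
      mul_inv_rev, Units.val_mul]
  have hcP : Continuous fun s => P s τ :=
    continuous_iff_continuousAt.2 fun s => (hP s τ).continuousAt
  have hcPi := continuous_inverse_propagator hP hPinv τ
  have hpair : Continuous fun s : ℝ => (s, τ) := by fun_prop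
  have hcA₁ : Continuous fun s => A₁ s τ := hA₁.continuous.comp hpair
  have hcA₀ : Continuous fun s => A₀ s τ := hA₀.continuous.comp hpair
  have hcd₀ : Continuous fun s => deriv (fun s => A₀ s τ) s :=
    hA₀.continuous_deriv_left.comp hpair
  have hcd₁ : Continuous fun s => deriv (fun t => A₁ s t) τ :=
    hA₁.continuous_deriv_right.comp hpair
  set J := ∫ s in σ₀..σ, Ring.inverse (P s τ) * deriv (fun t => A₁ s t) τ * P s τ with hJ
  have hint₀ : IntervalIntegrable (fun s => Ring.inverse (P s τ) *
      (deriv (fun s => A₀ s τ) s + (A₀ s τ * A₁ s τ - A₁ s τ * A₀ s τ)) * P s τ)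
      MeasureTheory.volume σ₀ σ := Continuous.intervalIntegrable
    ((hcPi.mul (hcd₀.add ((hcA₀.mul hcA₁).sub (hcA₁.mul hcA₀)))).mul hcP) _ _
  have hint₁ : IntervalIntegrable (fun s => Ring.inverse (P s τ) *
      deriv (fun t => A₁ s t) τ * P s τ) MeasureTheory.volume σ₀ σ :=
    Continuous.intervalIntegrable ((hcPi.mul hcd₁).mul hcP) _ _
  have hintegral : (∫ s in σ₀..σ, Ring.inverse (P s τ * Q σ₀ τ) *
        (deriv (fun s => A₀ s τ) s - deriv (fun t => A₁ s t) τ +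
          (A₀ s τ * A₁ s τ - A₁ s τ * A₀ s τ)) * (P s τ * Q σ₀ τ))
      = Ring.inverse (Q σ₀ τ) *
        (Ring.inverse (P σ τ) * A₀ σ τ * P σ τ - A₀ σ₀ τ - J) * Q σ₀ τ := by
    rw [← integral_inverse_mul_covariantDeriv_mul_propagator hA₀ hA₁ hP hP0 hPinv σ τ, hJ,
      ← intervalIntegral.integral_sub hint₀ hint₁,
      ← ContinuousLinearMap.mulLeftRight_apply ℝ E,
      ← ContinuousLinearMap.intervalIntegral_comp_comm _ (hint₀.sub hint₁)]
    refine intervalIntegral.integral_congr fun s _ => ?_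
    simp only [hinv, ContinuousLinearMap.mulLeftRight_apply]
    noncomm_ring
  rw [hintegral]
  simp only [hinv]
  have hdP := (hasDerivAt_propagator_right hA₁ hP hP0 hPinv σ τ).ringInverse (hPinv σ τ)
  have hdQ := (hQ σ₀ τ).ringInverse (hQinv σ₀ τ)
  refine (((hdQ.mul hdP).mul (hQ σ τ)).mul_const (P σ τ₀)).congr_deriv ?_
  simp only [← hJ, Pi.mul_apply]
  have hp : Ring.inverse (P σ τ) * P σ τ = 1 := Ring.inverse_mul_cancel _ (hPinv σ τ)
  have hp' : P σ τ * Ring.inverse (P σ τ) = 1 := Ring.mul_inverse_cancel _ (hPinv σ τ)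
  have hq : Q σ₀ τ * Ring.inverse (Q σ₀ τ) = 1 := Ring.mul_inverse_cancel _ (hQinv σ₀ τ)
  generalize Ring.inverse (P σ τ) = p at *
  generalize Ring.inverse (Q σ₀ τ) = q at *
  calc _ = (-(q * A₀ σ₀ τ * (Q σ₀ τ * q) * p * Q σ τ) - q * (p * P σ τ) * J * p * Q σ τ
        + q * p * A₀ σ τ * 1 * Q σ τ) * P σ τ₀ := by noncomm_ring
    _ = q * (p * A₀ σ τ * (P σ τ * p) - A₀ σ₀ τ * p - J * p) * Q σ τ * P σ τ₀ := by
        rw [hp, hp', hq]; noncomm_ring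
    _ = q * (p * A₀ σ τ * P σ τ - A₀ σ₀ τ - J) * 1 * p * Q σ τ * P σ τ₀ := by noncomm_ring
    _ = _ := by rw [← hq]; noncomm_ring

end WilsonLoop

end BanachAlgebra

/-- Theorem 2 (non-abelian Stokes theorem, surface-integral form): the Wilson loop
operator admits the surface product-integral representation
`W = ∏_{τ₀}^{τ} e^{∫_{σ₀}^{σ} T⁻¹(σ';τ') F₀₁(σ';τ') T(σ';τ') dσ' dτ'}`, where
`F₀₁ = ∂_σ A₀ − ∂_τ A₁ + [A₀, A₁]`. -/
theorem wilson_loop_surface_representation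
    (n : ℕ) (hn : 1 ≤ n)
    (A₀ A₁ : ℝ → ℝ → Matrix (Fin n) (Fin n) ℂ)
    (hA₀ : ContDiff ℝ 1 fun p : ℝ × ℝ => A₀ p.1 p.2)
    (hA₁ : ContDiff ℝ 1 fun p : ℝ × ℝ => A₁ p.1 p.2)
    (σ₀ τ₀ : ℝ)
    (P Q : ℝ → ℝ → Matrix (Fin n) (Fin n) ℂ)
    (hP : ∀ (σ τ : ℝ), HasDerivAt (fun σ' : ℝ => P σ' τ) (A₁ σ τ * P σ τ) σ)
    (hP0 : ∀ τ : ℝ, P σ₀ τ = 1)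
    (hPinv : ∀ (σ τ : ℝ), IsUnit (P σ τ))
    (hQ : ∀ (σ τ : ℝ), HasDerivAt (fun τ' : ℝ => Q σ τ') (A₀ σ τ * Q σ τ) τ)
    (hQ0 : ∀ σ : ℝ, Q σ τ₀ = 1)
    (hQinv : ∀ (σ τ : ℝ), IsUnit (Q σ τ))
    (T : ℝ → ℝ → Matrix (Fin n) (Fin n) ℂ)
    (hT : ∀ (σ τ : ℝ), T σ τ = P σ τ * Q σ₀ τ)
    (W : ℝ → ℝ → Matrix (Fin n) (Fin n) ℂ)
    (hW : ∀ (σ τ : ℝ), W σ τ = (T σ τ)⁻¹ * Q σ τ * P σ τ₀)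
    (σ : ℝ) (Y : ℝ → Matrix (Fin n) (Fin n) ℂ)
    (hY : ∀ τ' : ℝ, HasDerivAt Y
      ((∫ σ' in σ₀..σ,
          (T σ' τ')⁻¹ *
            (deriv (fun s : ℝ => A₀ s τ') σ' - deriv (fun t : ℝ => A₁ σ' t) τ' +
              (A₀ σ' τ' * A₁ σ' τ' - A₁ σ' τ' * A₀ σ' τ')) * T σ' τ') *
        Y τ') τ')
    (hY0 : Y τ₀ = 1) :
    ∀ τ : ℝ, W σ τ = Y τ := by
  have hderiv := hasDerivAt_wilsonLoop (τ₀ := τ₀) hA₀ hA₁ hP hP0 hPinv hQ hQinv σ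
  simp only [hW, hT, Matrix.nonsing_inv_eq_ringInverse] at hY ⊢
  refine eq_of_hasDerivAt_mul hderiv hY (fun t => ?_) (t₀ := τ₀) ?_
  · exact (((hPinv σ t).mul (hQinv σ₀ t)).ringInverse.mul (hQinv σ t)).mul (hPinv σ τ₀)
  · simp [hQ0, hY0, Ring.inverse_mul_cancel _ (hPinv σ τ₀)]
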